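/- Suppose (X,T) satisfies the global specification property with gap constants M(ε). Then for every ε>0, all k,n ∈ ℕ and every M ≥ M(ε) there exists an ε-independent set 𝒫 ⊂ P_{k(n+M)}. -/

import Mathlib

open Filter Topology MeasureTheory

section Defs

variable {X : Type*}

/-- Periodic points of period `n`: `P_n = {x : T^n x = x}`. -/
def per (T : X → X) (n : ℕ) : Set X := {x | T^[n] x = x}

/-- The set `P` of all periodic points. -/
def perP (T : X → X) : Set X := ⋃ n : ℕ, per T (n + 1)

/-- The Bowen ball `B_ε^n(x) = {y : d_n(x,y) < ε}`. -/
def bowen [PseudoMetricSpace X] (T : X → X) (n : ℕ) (ε : ℝ) (x : X) : Set X :=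
  {y | ∀ k < n, dist (T^[k] x) (T^[k] y) < ε}

/-- The global specification property, with gap constants `M ε`. -/
def GlobalSpec [PseudoMetricSpace X] (T : X → X) (M : ℝ → ℕ) : Prop :=
  ∀ ε > (0 : ℝ), ∀ Mg, M ε ≤ Mg → ∀ k n : ℕ, ∀ x : Fin k → X,
    ∃ p ∈ per T (k * (n + Mg)), ∀ i : Fin k, T^[i.val * (n + Mg)] p ∈ bowen T n ε (x i)

/-- The Birkhoff sum `S_m^n h (x) = ∑_{i=m}^{m+n-1} h (T^i x)`. -/
noncomputable def birk (T : X → X) (h : X → ℝ) (m n : ℕ) (x : X) : ℝ :=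
  ∑ i ∈ Finset.range n, h (T^[m + i] x)

/-- The oscillation `ω_m^n(h, ε, x)` of `h` (as a function on the periodic points `P`). -/
noncomputable def osc [PseudoMetricSpace X] (T : X → X) (h : X → ℝ) (m n : ℕ) (ε : ℝ)
    (x : X) : ℝ :=
  sSup {r | ∃ y ∈ bowen T n ε (T^[m] x) ∩ perP T, r = |birk T h m n x - birk T h 0 n y|}

/-- An `ε`-independent set `P ⊆ P_{k(n+M)}`. -/
def IsEpsIndep [PseudoMetricSpace X] (T : X → X) (ε : ℝ) (k n M : ℕ) (P : Finset X) : Prop :=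
  ↑P ⊆ per T (k * (n + M)) ∧
  ∃ E : Finset X, ↑E ⊆ per T (n + M) ∧
    per T (k * (n + M)) ⊆ ⋃ x ∈ E, bowen T n (3 * ε) x ∧
    ∃ Φ : (Fin k → E) → P, Function.Bijective Φ ∧
      ∀ (x : Fin k → E) (i : Fin k), T^[i.val * (n + M)] (Φ x : X) ∈ bowen T n ε (x i : X)

end Defs

section Prob

variable {α : Type*}

/-- Expectation with respect to the uniform measure on a finite set. -/
noncomputable def fexp (Z : Finset α) (h : α → ℝ) : ℝ := (∑ z ∈ Z, h z) / Z.card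

/-- Variance with respect to the uniform measure on a finite set. -/
noncomputable def fvar (Z : Finset α) (h : α → ℝ) : ℝ := fexp Z fun z => (h z - fexp Z h) ^ 2

open Classical in
/-- The uniform probability of `W` for the uniform measure on the finite set `Z`. -/
noncomputable def fprob (Z : Finset α) (W : Set α) : ℝ :=
  ((Z.filter fun z => z ∈ W).card : ℝ) / Z.card

open Classical in
/-- The Lindeberg function `L_Z(h, η)`. -/
noncomputable def flind (Z : Finset α) (h : α → ℝ) (η : ℝ) : ℝ :=
  fexp Z fun z => if η < |h z - fexp Z h| then (h z - fexp Z h) ^ 2 else 0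

end Prob

/-- The distribution function of the standard normal distribution. -/
noncomputable def stdNormalCDF (t : ℝ) : ℝ :=
  (Real.sqrt (2 * Real.pi))⁻¹ * ∫ u in Set.Iic t, Real.exp (-u ^ 2 / 2)

/-- For a reflexive and symmetric relation, every finite set contains a maximal subset of pairwise
unrelated elements. -/
theorem exists_pairwise_not_rel_dominating {α : Type*} (r : α → α → Prop) (hrefl : ∀ a, r a a)
    (hsymm : ∀ a b, r a b → r b a) (A : Finset α) :
    ∃ E ⊆ A, (∀ a ∈ E, ∀ b ∈ E, r a b → a = b) ∧ ∀ a ∈ A, ∃ e ∈ E, r e a := by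
  classical
  induction A using Finset.induction_on with
  | empty => exact ⟨∅, by simp⟩
  | insert a A _ ih =>
    obtain ⟨E, hEA, hE, hdom⟩ := ih
    by_cases h : ∃ e ∈ E, r e a
    · refine ⟨E, hEA.trans (Finset.subset_insert a A), hE, fun b hb => ?_⟩
      rcases Finset.mem_insert.1 hb with rfl | hb
      exacts [h, hdom b hb]
    · push Not at h
      refine ⟨insert a E, Finset.insert_subset_insert a hEA, ?_, ?_⟩
      · intro x hx y hy hxy
        rcases Finset.mem_insert.1 hx with rfl | hx' <;>
          rcases Finset.mem_insert.1 hy with rfl | hy'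
        · rfl
        · exact absurd (hsymm _ _ hxy) (h y hy')
        · exact absurd hxy (h x hx')
        · exact hE x hx' y hy' hxy
      · intro b hb
        rcases Finset.mem_insert.1 hb with rfl | hb
        · exact ⟨b, Finset.mem_insert_self b E, hrefl b⟩
        · obtain ⟨e, he, hr⟩ := hdom b hb
          exact ⟨e, Finset.mem_insert_of_mem he, hr⟩

theorem mem_bowen_comm {X : Type*} [PseudoMetricSpace X] {T : X → X} {n : ℕ} {ε : ℝ} {x y : X} :
    y ∈ bowen T n ε x ↔ x ∈ bowen T n ε y :=
  forall₂_congr fun _ _ => by rw [dist_comm]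

theorem mem_bowen_add {X : Type*} [PseudoMetricSpace X] {T : X → X} {n : ℕ} {δ ε : ℝ} {x y z : X}
    (hxy : y ∈ bowen T n δ x) (hyz : z ∈ bowen T n ε y) : z ∈ bowen T n (δ + ε) x :=
  fun j hj => (dist_triangle _ _ _).trans_lt (add_lt_add (hxy j hj) (hyz j hj))

/-- Under global specification, finitely many points of period `n + Mg` already `(n, ε)`-span the
whole space. -/
theorem GlobalSpec.exists_finset_span {X : Type*} [PseudoMetricSpace X] {T : X → X} {M : ℝ → ℕ}
    (hspec : GlobalSpec T M) (hfin : ∀ n : ℕ, (per T (n + 1)).Finite)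
    {ε : ℝ} (hε : 0 < ε) (n : ℕ) {Mg : ℕ} (hM : M ε ≤ Mg) :
    ∃ A : Finset X, ↑A ⊆ per T (n + Mg) ∧ ∀ x, ∃ a ∈ A, x ∈ bowen T n ε a := by
  have hshadow (x : X) : ∃ p ∈ per T (n + Mg), x ∈ bowen T n ε p := by
    obtain ⟨p, hp, hpx⟩ := hspec ε hε Mg hM 1 n fun _ => x
    exact ⟨p, by simpa using hp, mem_bowen_comm.1 (by simpa using hpx 0)⟩
  rcases n with _ | n
  · obtain ⟨x, -, -⟩ := hspec ε hε Mg hM 0 0 Fin.elim0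
    obtain ⟨p, hp, -⟩ := hshadow x
    exact ⟨{p}, by simpa using hp, fun y => ⟨p, by simp, fun j hj => absurd hj (Nat.not_lt_zero j)⟩⟩
  · have hf : (per T (n + 1 + Mg)).Finite := by
      rw [Nat.add_right_comm]
      exact hfin (n + Mg)
    exact ⟨hf.toFinset, by simp, fun x => by simpa using hshadow x⟩

/-- Under global specification, for every `ε > 0`, `k, n ∈ ℕ` and `M ≥ M(ε)` there exists an
`ε`-independent set `𝒫 ⊆ P_{k(n+M)}`. -/
theorem stmt1 {X : Type*} [MetricSpace X] [CompactSpace X] (T : X → X)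
    (hT : Continuous T) (hfin : ∀ n : ℕ, (per T (n + 1)).Finite)
    (M : ℝ → ℕ) (hspec : GlobalSpec T M)
    (ε : ℝ) (hε : 0 < ε) (k n Mg : ℕ) (hM : M ε ≤ Mg) :
    ∃ P : Finset X, IsEpsIndep T ε k n Mg P := by
  classical
  obtain ⟨A, hA, hspan⟩ := hspec.exists_finset_span hfin hε n hM
  obtain ⟨E, hEA, hsep, hdom⟩ := exists_pairwise_not_rel_dominating
    (fun x y => y ∈ bowen T n (ε + ε) x) (fun x j _ => by rw [dist_self]; positivity)
    (fun _ _ => mem_bowen_comm.1) A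
  choose p hp hpx using fun x : Fin k → E => hspec ε hε Mg hM k n fun i => (x i : X)
  have hinj : Function.Injective p := fun x y hxy => funext fun i =>
    Subtype.ext <| hsep _ (x i).2 _ (y i).2 <|
      mem_bowen_add (hpx x i) (mem_bowen_comm.1 (hxy ▸ hpx y i))
  refine ⟨Finset.univ.image p, ?_, E, fun x hx => hA (hEA hx), ?_,
    fun x => ⟨p x, Finset.mem_image_of_mem p (Finset.mem_univ x)⟩, ⟨?_, ?_⟩, hpx⟩
  · intro q hq
    obtain ⟨x, -, rfl⟩ := Finset.mem_image.1 (Finset.mem_coe.1 hq)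
    exact hp x
  · intro y _
    obtain ⟨a, ha, hya⟩ := hspan y
    obtain ⟨e, he, hae⟩ := hdom a ha
    refine Set.mem_iUnion₂.2 ⟨e, he, ?_⟩
    rw [show 3 * ε = ε + ε + ε by ring]
    exact mem_bowen_add hae hya
  · exact fun x y hxy => hinj (congrArg Subtype.val hxy)
  · rintro ⟨q, hq⟩
    obtain ⟨x, -, rfl⟩ := Finset.mem_image.1 hq
    exact ⟨x, rfl⟩
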